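/- Let H ≤ F be a subgroup and let Σ = { ω ∈ ∂F : Σ_{h∈H} (2m−1)^{−b_ω(h)} = ∞ }. Then Σ is H-invariant and coincides, up to μ-null sets, with the conservative part of the action of H on (∂F, μ); explicitly: (i) for every measurable A ⊆ Σ with μ(A) > 0 there exists h ∈ H with h ≠ 1 and μ(A ∩ h·A) > 0; and (ii) there exists a measurable set W ⊆ ∂F with μ(hW ∩ h′W) = 0 for all h ≠ h′ in H, such that ⋃_{h∈H} h·W coincides with ∂F \ Σ up to a μ-null set. -/

import Mathlib

open MeasureTheory Filter Topology
open scoped ENNReal symmDiff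

noncomputable section

/-- A letter of the alphabet `A ∪ A⁻¹` for the free group on `Fin m`. -/
abbrev Letter (m : ℕ) := Fin m × Bool

/-- The inverse letter. -/
def linv {m : ℕ} (x : Letter m) : Letter m := (x.1, !x.2)

/-- A sequence of letters is reduced if no letter is followed by its inverse. -/
def IsRedSeq {m : ℕ} (ω : ℕ → Letter m) : Prop := ∀ n, ω (n + 1) ≠ linv (ω n)

/-- The boundary `∂F`: infinite reduced words. -/
abbrev Boundary (m : ℕ) := {ω : ℕ → Letter m // IsRedSeq ω}

/-- Word length of an element of the free group. -/
def wlen {m : ℕ} (g : FreeGroup (Fin m)) : ℕ := g.toWord.length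

/-- The truncation `[ω]ₙ`: the group element given by the first `n` letters of `ω`. -/
def trunc {m : ℕ} (ω : Boundary m) (n : ℕ) : FreeGroup (Fin m) :=
  FreeGroup.mk (List.ofFn fun i : Fin n => ω.1 i)

/-- Cylinder set `C_g`. -/
def cylinder {m : ℕ} (g : FreeGroup (Fin m)) : Set (Boundary m) :=
  {ω | trunc ω (wlen g) = g}

/-- The Gromov product `(g|ω)`: length of the longest common initial segment of the
reduced word of `g` and `ω`. -/
def gromov {m : ℕ} (g : FreeGroup (Fin m)) (ω : Boundary m) : ℕ :=
  sSup {k | ∀ i < k, g.toWord[i]? = some (ω.1 i)}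

/-- The Busemann function `b_ω(g) = |g| - 2 (g|ω)`. -/
def busemann {m : ℕ} (g : FreeGroup (Fin m)) (ω : Boundary m) : ℤ :=
  (wlen g : ℤ) - 2 * (gromov g ω : ℤ)

/-- The number of letters cancelled in the free reduction of the concatenation
of a finite word `w` with an infinite reduced word `ω`. -/
def cancelLen {m : ℕ} (w : List (Letter m)) (ω : ℕ → Letter m) : ℕ :=
  sSup {k | k ≤ w.length ∧ ∀ i < k, w[w.length - 1 - i]? = some (linv (ω i))}

/-- The sequence of letters of the free reduction of (reduced word of `g`) ++ `ω`. -/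
def actSeq {m : ℕ} (g : FreeGroup (Fin m)) (ω : Boundary m) (n : ℕ) : Letter m :=
  if h : n < g.toWord.length - cancelLen g.toWord ω.1
  then g.toWord[n]'(by omega)
  else ω.1 (n - (g.toWord.length - cancelLen g.toWord ω.1) + cancelLen g.toWord ω.1)

theorem linv_linv {m : ℕ} (x : Letter m) : linv (linv x) = x := by
  simp [linv]

theorem toWord_chain {m : ℕ} (g : FreeGroup (Fin m)) {j : ℕ} (hj : j + 1 < g.toWord.length) :
    g.toWord[j + 1]'hj ≠ linv (g.toWord[j]'(by omega)) := by
  intro h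
  have hsplit : g.toWord = g.toWord.take j ++
      (g.toWord[j]'(by omega)) :: (g.toWord[j+1]'hj) :: g.toWord.drop (j + 2) := by
    conv_lhs => rw [← List.take_append_drop j g.toWord]
    congr 1
    rw [List.drop_eq_getElem_cons (by omega)]
    congr 1
    rw [List.drop_eq_getElem_cons (by omega)]
  rw [h] at hsplit
  have hred : FreeGroup.reduce g.toWord = g.toWord := FreeGroup.reduce_toWord g
  exact FreeGroup.reduce.not (by rw [hred, hsplit]; rfl)

theorem cancelLen_spec {m : ℕ} (w : List (Letter m)) (ω : ℕ → Letter m) :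
    cancelLen w ω ≤ w.length ∧
      ∀ i < cancelLen w ω, w[w.length - 1 - i]? = some (linv (ω i)) := by
  have : cancelLen w ω ∈
      {k | k ≤ w.length ∧ ∀ i < k, w[w.length - 1 - i]? = some (linv (ω i))} := by
    apply Nat.sSup_mem ⟨0, by simp⟩ ⟨w.length, fun x hx => hx.1⟩
  exact this

theorem cancelLen_max {m : ℕ} (w : List (Letter m)) (ω : ℕ → Letter m)
    (hlt : cancelLen w ω < w.length) :
    w[w.length - 1 - cancelLen w ω]? ≠ some (linv (ω (cancelLen w ω))) := by
  intro hcon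
  have hmem : cancelLen w ω + 1 ∈
      {k | k ≤ w.length ∧ ∀ i < k, w[w.length - 1 - i]? = some (linv (ω i))} := by
    refine ⟨hlt, fun i hi => ?_⟩
    rcases Nat.lt_succ_iff_lt_or_eq.mp hi with h | h
    · exact (cancelLen_spec w ω).2 i h
    · subst h; exact hcon
  have := le_csSup ⟨w.length, fun x hx => hx.1⟩ hmem
  simp only [cancelLen] at this ⊢
  omega

theorem isRedSeq_actSeq {m : ℕ} (g : FreeGroup (Fin m)) (ω : Boundary m) :
    IsRedSeq (actSeq g ω) := by
  intro n
  obtain ⟨hkle, hcan⟩ := cancelLen_spec g.toWord ω.1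
  by_cases h1 : n + 1 < g.toWord.length - cancelLen g.toWord ω.1
  · have h0 : n < g.toWord.length - cancelLen g.toWord ω.1 := by omega
    rw [show actSeq g ω (n + 1) = g.toWord[n + 1]'(by omega) from dif_pos h1,
        show actSeq g ω n = g.toWord[n]'(by omega) from dif_pos h0]
    exact toWord_chain g (by omega)
  · by_cases h0 : n < g.toWord.length - cancelLen g.toWord ω.1
    · have hklt : cancelLen g.toWord ω.1 < g.toWord.length := by omega
      have hidx : n = g.toWord.length - 1 - cancelLen g.toWord ω.1 := by omega
      have e0 : actSeq g ω n = g.toWord[n]'(by omega) := dif_pos h0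
      have e1 : actSeq g ω (n + 1) =
          ω.1 (n + 1 - (g.toWord.length - cancelLen g.toWord ω.1) +
            cancelLen g.toWord ω.1) := dif_neg h1
      have harg : n + 1 - (g.toWord.length - cancelLen g.toWord ω.1) +
          cancelLen g.toWord ω.1 = cancelLen g.toWord ω.1 := by omega
      rw [harg] at e1
      rw [e0, e1]
      intro hcon
      apply cancelLen_max g.toWord ω.1 hklt
      subst hidx
      rw [List.getElem?_eq_getElem (by omega), hcon, linv_linv]
    · have e0 : actSeq g ω n =
          ω.1 (n - (g.toWord.length - cancelLen g.toWord ω.1) +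
            cancelLen g.toWord ω.1) := dif_neg h0
      have e1 : actSeq g ω (n + 1) =
          ω.1 (n + 1 - (g.toWord.length - cancelLen g.toWord ω.1) +
            cancelLen g.toWord ω.1) := dif_neg (by omega)
      have harg : n + 1 - (g.toWord.length - cancelLen g.toWord ω.1) +
          cancelLen g.toWord ω.1 =
          (n - (g.toWord.length - cancelLen g.toWord ω.1) + cancelLen g.toWord ω.1) + 1 := by
        omega
      rw [e0, e1, harg]
      exact ω.2 _

/-- The boundary action of `F` on `∂F`: `g · ω` is the free reduction of the
concatenation of the reduced word of `g` with `ω`. -/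
def bact {m : ℕ} (g : FreeGroup (Fin m)) (ω : Boundary m) : Boundary m :=
  ⟨actSeq g ω, isRedSeq_actSeq g ω⟩


section Combinatorics

variable {m : ℕ}

theorem toWord_trunc (ω : Boundary m) (n : ℕ) :
    (trunc ω n).toWord = List.ofFn fun i : Fin n => ω.1 i := by
  rw [trunc, FreeGroup.toWord_mk]
  refine FreeGroup.IsReduced.reduce_eq ?_
  refine List.isChain_iff_getElem.2 fun i hi h => ?_
  have := ω.2 i
  simp only [List.getElem_ofFn] at h ⊢
  by_contra h2
  refine this (Prod.ext h.symm ?_)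
  simpa [linv] using (Bool.eq_not_of_ne (Ne.symm h2))

@[simp] theorem wlen_trunc (ω : Boundary m) (n : ℕ) : wlen (trunc ω n) = n := by
  simp [wlen, toWord_trunc]

theorem getElem?_toWord_trunc (ω : Boundary m) {n i : ℕ} (h : i < n) :
    (trunc ω n).toWord[i]? = some (ω.1 i) := by
  simp [toWord_trunc, h]

theorem trunc_eq_trunc_of_le {ω ω' : Boundary m} {k n : ℕ} (hk : k ≤ n)
    (h : trunc ω n = trunc ω' n) : trunc ω k = trunc ω' k := by
  unfold trunc
  congr 2
  ext1 i
  have h1 := getElem?_toWord_trunc ω (i.2.trans_le hk)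
  rw [h, getElem?_toWord_trunc ω' (i.2.trans_le hk)] at h1
  exact (Option.some_inj.1 h1).symm

theorem eq_of_frequently_trunc_eq {ω ω' : Boundary m}
    (h : ∀ k, ∃ n, k < n ∧ trunc ω n = trunc ω' n) : ω = ω' := by
  ext1
  funext k
  obtain ⟨n, hk, hn⟩ := h k
  have h1 := getElem?_toWord_trunc ω hk
  rw [hn, getElem?_toWord_trunc ω' hk] at h1
  exact (Option.some_inj.1 h1).symm

theorem gromov_inv (g : FreeGroup (Fin m)) (ω : Boundary m) :
    gromov g⁻¹ ω = cancelLen g.toWord ω.1 := by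
  unfold gromov cancelLen
  congr 1
  ext k
  have key : ∀ i < g.toWord.length, ((g⁻¹).toWord[i]? = some (ω.1 i) ↔
      g.toWord[g.toWord.length - 1 - i]? = some (linv (ω.1 i))) := by
    intro i hi
    rw [FreeGroup.toWord_inv, FreeGroup.invRev, List.getElem?_reverse (by simpa using hi)]
    simp only [List.length_map, List.getElem?_map]
    rw [List.getElem?_eq_getElem (by omega)]
    simp only [Option.map_some, Option.some_inj]
    constructor
    · intro h
      rw [← h]
      simp [linv]
    · intro h
      rw [h]
      simp [linv]
  have hlen : (g⁻¹).toWord.length = g.toWord.length := by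
    simp [FreeGroup.toWord_inv]
  simp only [Set.mem_ofPred_eq]
  constructor
  · intro h
    have hk : k ≤ g.toWord.length := by
      by_contra! hk
      have := h _ hk
      rw [List.getElem?_eq_none (by omega)] at this
      simp at this
    exact ⟨hk, fun i hi => (key i (by omega)).1 (h i hi)⟩
  · rintro ⟨hk, h⟩ i hi
    exact (key i (by omega)).2 (h i hi)

theorem mul_trunc_of_cancelLen_le (g : FreeGroup (Fin m)) (ω : Boundary m) {n : ℕ}
    (hn : cancelLen g.toWord ω.1 ≤ n) :
    g * trunc ω n = trunc (bact g ω)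
      (g.toWord.length - cancelLen g.toWord ω.1 + (n - cancelLen g.toWord ω.1)) := by
  obtain ⟨hk, hc⟩ := cancelLen_spec g.toWord ω.1
  have hw : g.toWord = g.toWord.take (g.toWord.length - cancelLen g.toWord ω.1) ++
      FreeGroup.invRev (List.ofFn fun i : Fin (cancelLen g.toWord ω.1) => ω.1 i) := by
    conv_lhs => rw [← List.take_append_drop
      (g.toWord.length - cancelLen g.toWord ω.1) g.toWord]
    congr 1
    refine List.ext_getElem (by simp; omega) fun i h1 h2 => ?_
    simp only [FreeGroup.invRev_length, List.length_ofFn] at h2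
    have h3 := hc (cancelLen g.toWord ω.1 - 1 - i) (by omega)
    rw [List.getElem?_eq_getElem (by omega), Option.some_inj] at h3
    have h4 : g.toWord.length - 1 - (cancelLen g.toWord ω.1 - 1 - i) =
      g.toWord.length - cancelLen g.toWord ω.1 + i := by omega
    simp only [h4] at h3
    simp [FreeGroup.invRev, h3, linv]
  have hω : (List.ofFn fun i : Fin n => ω.1 i) =
      (List.ofFn fun i : Fin (cancelLen g.toWord ω.1) => ω.1 i) ++
      (List.ofFn fun i : Fin (n - cancelLen g.toWord ω.1) =>
        ω.1 (cancelLen g.toWord ω.1 + i)) := by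
    refine List.ext_getElem (by simp; omega) fun i h1 h2 => ?_
    simp only [List.getElem_ofFn, List.getElem_append, List.length_ofFn]
    split_ifs with h
    · rfl
    · exact congrArg ω.1 (by omega)
  have hact : (List.ofFn fun i : Fin (g.toWord.length - cancelLen g.toWord ω.1 +
        (n - cancelLen g.toWord ω.1)) => (bact g ω).1 i) =
      g.toWord.take (g.toWord.length - cancelLen g.toWord ω.1) ++
      (List.ofFn fun i : Fin (n - cancelLen g.toWord ω.1) =>
        ω.1 (cancelLen g.toWord ω.1 + i)) := by
    refine List.ext_getElem (by simp) fun i h1 h2 => ?_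
    simp only [List.getElem_ofFn, List.getElem_append, List.length_take, bact, actSeq,
      min_eq_left (Nat.sub_le _ _)]
    split_ifs with h3
    · simp
    · exact congrArg ω.1 (by omega)
  have hg : g = FreeGroup.mk (g.toWord.take (g.toWord.length - cancelLen g.toWord ω.1)) *
      (FreeGroup.mk (List.ofFn fun i : Fin (cancelLen g.toWord ω.1) => ω.1 i))⁻¹ := by
    rw [FreeGroup.inv_mk, FreeGroup.mul_mk, ← hw, FreeGroup.mk_toWord]
  rw [trunc, trunc, hact, ← FreeGroup.mul_mk, hω, ← FreeGroup.mul_mk]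
  nth_rewrite 1 [hg]
  group

/-- Translating a long initial segment of `ω` by `g⁻¹` gives an initial segment of `g⁻¹ · ω`,
whose length is shifted by the Busemann function. -/
theorem exists_inv_mul_trunc (g : FreeGroup (Fin m)) (ω : Boundary m) {n : ℕ}
    (hn : wlen g ≤ n) :
    ∃ N : ℕ, (N : ℤ) = n + busemann g ω ∧ g⁻¹ * trunc ω n = trunc (bact g⁻¹ ω) N := by
  have hlen : (g⁻¹).toWord.length = wlen g := by
    simp [wlen, FreeGroup.toWord_inv]
  have h := gromov_inv g⁻¹ ω
  rw [inv_inv] at h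
  have hk := (cancelLen_spec (g⁻¹).toWord ω.1).1
  refine ⟨_, ?_, mul_trunc_of_cancelLen_le g⁻¹ ω (hk.trans (hlen.trans_le hn))⟩
  rw [busemann, h]
  omega

theorem wlen_inv (g : FreeGroup (Fin m)) : wlen g⁻¹ = wlen g := by
  simp [wlen, FreeGroup.toWord_inv]

theorem wlen_mul_le (g h : FreeGroup (Fin m)) : wlen (g * h) ≤ wlen g + wlen h :=
  FreeGroup.norm_mul_le g h

theorem le_wlen_mul (g h : FreeGroup (Fin m)) : wlen h ≤ wlen g + wlen (g * h) := by
  simpa [wlen_inv] using wlen_mul_le g⁻¹ (g * h)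

theorem wlen_inv_mul_trunc (g : FreeGroup (Fin m)) (ω : Boundary m) {n : ℕ}
    (hn : wlen g ≤ n) : (wlen (g⁻¹ * trunc ω n) : ℤ) = n + busemann g ω := by
  obtain ⟨N, hN, h⟩ := exists_inv_mul_trunc g ω hn
  rw [h, wlen_trunc, hN]

theorem mul_trunc (g : FreeGroup (Fin m)) (ω : Boundary m) {n : ℕ} (hn : wlen g ≤ n) :
    g * trunc ω n = trunc (bact g ω) (wlen (g * trunc ω n)) := by
  obtain ⟨N, hN, h⟩ := exists_inv_mul_trunc g⁻¹ ω (n := n) (by rwa [wlen_inv])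
  rw [inv_inv] at h
  rw [h, wlen_trunc]

theorem bact_one (ω : Boundary m) : bact 1 ω = ω := by
  refine eq_of_frequently_trunc_eq fun k => ⟨k + 1, by omega, ?_⟩
  have h := mul_trunc 1 ω (n := k + 1) (by simp [wlen])
  simpa using h.symm

theorem bact_mul (g h : FreeGroup (Fin m)) (ω : Boundary m) :
    bact (g * h) ω = bact g (bact h ω) := by
  refine eq_of_frequently_trunc_eq fun k => ?_
  let n := 2 * wlen h + 2 * wlen g + k + 1
  have e1 := mul_trunc h ω (n := n) (by omega)
  have l1 := le_wlen_mul h (trunc ω n)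
  have l2 := le_wlen_mul (g * h) (trunc ω n)
  have l3 := wlen_mul_le g h
  rw [wlen_trunc] at l1 l2
  have e2 := mul_trunc g (bact h ω) (n := wlen (h * trunc ω n)) (by omega)
  have e3 := mul_trunc (g * h) ω (n := n) (by omega)
  rw [← e1, ← mul_assoc] at e2
  exact ⟨wlen (g * h * trunc ω n), by omega, e3.symm.trans e2⟩

theorem bact_inv_bact (g : FreeGroup (Fin m)) (ω : Boundary m) : bact g⁻¹ (bact g ω) = ω := by
  rw [← bact_mul, inv_mul_cancel, bact_one]

theorem bact_bact_inv (g : FreeGroup (Fin m)) (ω : Boundary m) : bact g (bact g⁻¹ ω) = ω := by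
  rw [← bact_mul, mul_inv_cancel, bact_one]

theorem image_bact (g : FreeGroup (Fin m)) (s : Set (Boundary m)) :
    bact g '' s = bact g⁻¹ ⁻¹' s :=
  congrFun (Set.image_eq_preimage_of_inverse (bact_inv_bact g) (bact_bact_inv g)) s

theorem busemann_mul (g h : FreeGroup (Fin m)) (ω : Boundary m) :
    busemann (g * h) ω = busemann g ω + busemann h (bact g⁻¹ ω) := by
  let n := 2 * wlen g + 2 * wlen h
  have l1 := le_wlen_mul g⁻¹ (trunc ω n)
  have l3 := wlen_mul_le g h
  rw [wlen_trunc, wlen_inv] at l1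
  obtain ⟨N, hN, e1⟩ := exists_inv_mul_trunc g ω (n := n) (by omega)
  have e2 := wlen_inv_mul_trunc (g * h) ω (n := n) (by omega)
  rw [e1, wlen_trunc] at l1
  have e3 := wlen_inv_mul_trunc h (bact g⁻¹ ω) (n := N) (by omega)
  rw [← e1, ← mul_assoc, ← mul_inv_rev] at e3
  omega

theorem busemann_one (ω : Boundary m) : busemann 1 ω = 0 := by
  simpa [bact_one] using busemann_mul 1 1 ω

end Combinatorics

section Measure

variable {m : ℕ}

theorem measurable_comp_trunc {β : Type*} [MeasurableSpace β] (f : FreeGroup (Fin m) → β)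
    (n : ℕ) : Measurable fun ω : Boundary m => f (trunc ω n) := by
  have h : Measurable fun ω : Boundary m => fun i : Fin n => ω.1 i :=
    measurable_pi_lambda _ fun i => (measurable_pi_apply _).comp measurable_subtype_coe
  exact (Measurable.of_discrete
    (f := fun v : Fin n → Letter m => f (FreeGroup.mk (List.ofFn v)))).comp h

theorem measurableSet_cylinder (g : FreeGroup (Fin m)) : MeasurableSet (cylinder g) := by
  have h := measurable_comp_trunc (fun x => x = g) (wlen g)
  exact measurableSet_setOfPred.2 h

theorem busemann_eq (g : FreeGroup (Fin m)) (ω : Boundary m) :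
    busemann g ω = wlen (g⁻¹ * trunc ω (wlen g)) - (wlen g : ℤ) := by
  have h := wlen_inv_mul_trunc g ω le_rfl
  omega

theorem measurable_busemann (g : FreeGroup (Fin m)) :
    Measurable fun ω : Boundary m => busemann g ω := by
  simp only [busemann_eq]
  exact measurable_comp_trunc (fun x => (wlen (g⁻¹ * x) : ℤ) - wlen g) (wlen g)

theorem measurable_bact (g : FreeGroup (Fin m)) : Measurable (bact g) := by
  refine Measurable.subtype_mk (measurable_pi_lambda _ fun n => ?_)
  have h : ∀ ω : Boundary m, ∀ k, actSeq g ω n = k ↔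
      (g * trunc ω (n + 1 + wlen g)).toWord[n]? = some k := by
    intro ω k
    have h1 := le_wlen_mul g (trunc ω (n + 1 + wlen g))
    rw [wlen_trunc] at h1
    rw [mul_trunc g ω (by omega), getElem?_toWord_trunc _ (by omega), Option.some_inj]
    rfl
  refine measurable_to_countable' fun k => ?_
  have h2 := measurable_comp_trunc (m := m) (fun x => (g * x).toWord[n]? = some k)
    (n + 1 + wlen g)
  refine (measurableSet_setOfPred.2 h2).congr ?_
  ext ω
  exact (h ω k).symm

/-- Long cylinders generate the Borel `σ`-algebra of the boundary. -/
theorem borel_eq_generateFrom_cylinder (N : ℕ) :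
    (inferInstance : MeasurableSpace (Boundary m)) =
      MeasurableSpace.generateFrom (cylinder '' {g : FreeGroup (Fin m) | N ≤ wlen g}) := by
  refine le_antisymm ?_ (MeasurableSpace.generateFrom_le ?_)
  · refine measurable_iff_comap_le.1 ?_
    refine @measurable_pi_lambda _ _ _ (_) _ _ fun i => ?_
    refine @measurable_to_countable' _ _ _ _ (_) _ fun k => ?_
    have h : (fun ω : Boundary m => ω.1 i) ⁻¹' {k} =
        ⋃ g ∈ {g : FreeGroup (Fin m) | wlen g = N + i + 1 ∧ g.toWord[i]? = some k},
          cylinder g := by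
      ext ω
      simp only [Set.mem_preimage, Set.mem_singleton_iff, Set.mem_iUnion, Set.mem_ofPred_eq,
        _root_.cylinder, exists_prop]
      constructor
      · intro h
        refine ⟨trunc ω (N + i + 1), ⟨by simp, ?_⟩, by simp⟩
        rw [getElem?_toWord_trunc _ (by omega), h]
      · rintro ⟨g, ⟨hg, h⟩, hω⟩
        rw [← hω, hg, getElem?_toWord_trunc _ (by omega)] at h
        exact Option.some_inj.1 h
    rw [h]
    refine @MeasurableSet.biUnion _ _ (_) _ _ (Set.to_countable _) fun g hg => ?_
    have hN : N ≤ wlen g := by rw [hg.1]; omega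
    exact MeasurableSpace.measurableSet_generateFrom ⟨g, hN, rfl⟩
  · rintro _ ⟨g, -, rfl⟩
    exact measurableSet_cylinder g

theorem isPiSystem_cylinder (N : ℕ) :
    IsPiSystem (cylinder '' {g : FreeGroup (Fin m) | N ≤ wlen g}) := by
  have key : ∀ g g' : FreeGroup (Fin m), wlen g ≤ wlen g' →
      (cylinder g ∩ cylinder g').Nonempty → cylinder g ∩ cylinder g' = cylinder g' := by
    rintro g g' hle ⟨ω, h, h'⟩
    refine Set.inter_eq_right.2 fun ω' hω' => ?_
    exact (trunc_eq_trunc_of_le hle (hω'.trans h'.symm)).trans h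
  rintro _ ⟨g, hg, rfl⟩ _ ⟨g', hg', rfl⟩ hne
  rcases le_total (wlen g) (wlen g') with hle | hle
  · exact ⟨g', hg', (key g g' hle hne).symm⟩
  · rw [Set.inter_comm] at hne ⊢
    exact ⟨g, hg, (key g' g hle hne).symm⟩

theorem sUnion_cylinder (N : ℕ) :
    ⋃₀ (cylinder '' {g : FreeGroup (Fin m) | N ≤ wlen g}) = Set.univ := by
  refine Set.eq_univ_of_forall fun ω => ?_
  exact ⟨cylinder (trunc ω N), ⟨trunc ω N, by simp, rfl⟩, by simp [_root_.cylinder]⟩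

theorem preimage_bact_cylinder (h g : FreeGroup (Fin m)) (hg : 2 * wlen h ≤ wlen g) :
    bact h ⁻¹' cylinder g = cylinder (h⁻¹ * g) := by
  ext ω
  have l1 := le_wlen_mul h⁻¹ g
  rw [wlen_inv] at l1
  simp only [_root_.cylinder, Set.mem_preimage, Set.mem_ofPred_eq]
  constructor
  · intro hω
    have h1 := mul_trunc h⁻¹ (bact h ω) (n := wlen g) (by rw [wlen_inv]; omega)
    rw [bact_inv_bact, hω] at h1
    exact h1.symm
  · intro hω
    have h1 := mul_trunc h ω (n := wlen (h⁻¹ * g)) (by omega)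
    rw [hω, mul_inv_cancel_left] at h1
    exact h1.symm

/-- The Radon–Nikodym derivative of the `h`-translate of the uniform measure. -/
def density (h : FreeGroup (Fin m)) (ω : Boundary m) : ℝ≥0∞ :=
  ((2 * m - 1 : ℕ) : ℝ≥0∞) ^ (-(busemann h ω))

theorem measurable_density (h : FreeGroup (Fin m)) : Measurable (density h) :=
  (Measurable.of_discrete (f := fun k : ℤ => ((2 * m - 1 : ℕ) : ℝ≥0∞) ^ (-k))).comp
    (measurable_busemann h)

theorem density_one (ω : Boundary m) : density 1 ω = 1 := by
  simp [density, busemann_one]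

theorem density_mul (hm : 2 ≤ m) (g h : FreeGroup (Fin m)) (ω : Boundary m) :
    density (g * h) ω = density g ω * density h (bact g⁻¹ ω) := by
  have h0 : ((2 * m - 1 : ℕ) : ℝ≥0∞) ≠ 0 := by
    rw [Nat.cast_ne_zero]
    omega
  rw [density, busemann_mul, neg_add, ENNReal.zpow_add h0 (ENNReal.natCast_ne_top _)]
  rfl

theorem density_ne_top (hm : 2 ≤ m) (h : FreeGroup (Fin m)) (ω : Boundary m) :
    density h ω ≠ ⊤ := by
  have h0 : ((2 * m - 1 : ℕ) : ℝ≥0∞) ≠ 0 := by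
    rw [Nat.cast_ne_zero]
    omega
  exact ENNReal.zpow_ne_top h0 (ENNReal.natCast_ne_top _) _

theorem map_bact_eq_withDensity (hm : 2 ≤ m) (μ : Measure (Boundary m))
    [IsProbabilityMeasure μ]
    (hμ : ∀ g : FreeGroup (Fin m), g ≠ 1 →
      μ (cylinder g) = ((2 * m * (2 * m - 1) ^ (wlen g - 1) : ℕ) : ℝ≥0∞)⁻¹)
    (h : FreeGroup (Fin m)) : μ.map (bact h) = μ.withDensity (density h) := by
  have : IsProbabilityMeasure (μ.map (bact h)) :=
    Measure.isProbabilityMeasure_map (measurable_bact h).aemeasurable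
  have h0 : ((2 * m - 1 : ℕ) : ℝ≥0∞) ≠ 0 := by
    rw [Nat.cast_ne_zero]
    omega
  refine Measure.ext_of_generateFrom_of_cover_subset
    (borel_eq_generateFrom_cylinder (2 * wlen h + 1)) (isPiSystem_cylinder _) subset_rfl
    ((Set.to_countable _).image _) (sUnion_cylinder _) (fun s _ => measure_ne_top _ s) ?_
  rintro _ ⟨g, hg, rfl⟩
  simp only [Set.mem_ofPred_eq] at hg
  rw [Measure.map_apply (measurable_bact h) (measurableSet_cylinder g),
    preimage_bact_cylinder h g (by omega), withDensity_apply _ (measurableSet_cylinder g)]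
  have hd : ∀ ω ∈ cylinder g, density h ω =
      ((2 * m - 1 : ℕ) : ℝ≥0∞) ^ ((wlen g : ℤ) - wlen (h⁻¹ * g)) := by
    intro ω hω
    have h1 := wlen_inv_mul_trunc h ω (n := wlen g) (by omega)
    rw [show trunc ω (wlen g) = g from hω] at h1
    rw [density, h1]
    congr 1
    ring
  have l1 := le_wlen_mul h⁻¹ g
  rw [wlen_inv] at l1
  have hne : ∀ x : FreeGroup (Fin m), 0 < wlen x → x ≠ 1 := by
    rintro x hx rfl
    simp [wlen] at hx
  rw [setLIntegral_congr_fun (measurableSet_cylinder g) hd, setLIntegral_const,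
    hμ _ (hne g (by omega)), hμ _ (hne (h⁻¹ * g) (by omega))]
  have hpow : ∀ k : ℕ, 0 < k → ((2 * m * (2 * m - 1) ^ (k - 1) : ℕ) : ℝ≥0∞)⁻¹ =
      ((2 * m : ℕ) : ℝ≥0∞)⁻¹ * ((2 * m - 1 : ℕ) : ℝ≥0∞) ^ (1 - (k : ℤ)) := by
    intro k hk
    rw [Nat.cast_mul, ENNReal.mul_inv (Or.inr (ENNReal.natCast_ne_top _))
      (Or.inl (ENNReal.natCast_ne_top _)), Nat.cast_pow, ← zpow_natCast, ← ENNReal.zpow_neg]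
    congr 2
    omega
  rw [hpow _ (by omega), hpow _ (by omega), mul_left_comm,
    ← ENNReal.zpow_add h0 (ENNReal.natCast_ne_top _)]
  congr 2
  ring

end Measure

section Hopf

variable {m : ℕ}

theorem density_mul_density_inv (hm : 2 ≤ m) (g : FreeGroup (Fin m)) (ω : Boundary m) :
    density g ω * density g⁻¹ (bact g⁻¹ ω) = 1 := by
  rw [← density_mul hm, mul_inv_cancel, density_one]

theorem tsum_density_bact (hm : 2 ≤ m) (H : Subgroup (FreeGroup (Fin m))) (g : H)
    (ω : Boundary m) :
    ∑' h : H, density (h : FreeGroup (Fin m)) ω =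
      density ((g : FreeGroup (Fin m))⁻¹) ω *
        ∑' h : H, density (h : FreeGroup (Fin m)) (bact g ω) := by
  rw [← ENNReal.tsum_mul_left, ← (Equiv.mulLeft g⁻¹).tsum_eq]
  refine tsum_congr fun h => ?_
  simp [density_mul hm]

/-- The set of divergence of the Busemann–Poincaré series. -/
def divergenceSet (H : Subgroup (FreeGroup (Fin m))) : Set (Boundary m) :=
  {ω | ∑' h : H, density (h : FreeGroup (Fin m)) ω = ⊤}

theorem measurableSet_divergenceSet (H : Subgroup (FreeGroup (Fin m))) :
    MeasurableSet (divergenceSet H) :=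
  (Measurable.tsum fun h : H => measurable_density (h : FreeGroup (Fin m)))
    (measurableSet_singleton ⊤)

theorem bact_mem_divergenceSet_iff (hm : 2 ≤ m) (H : Subgroup (FreeGroup (Fin m))) (g : H)
    (ω : Boundary m) : bact g ω ∈ divergenceSet H ↔ ω ∈ divergenceSet H := by
  have key : ∀ (g : H) (ω : Boundary m), ω ∈ divergenceSet H → bact g ω ∈ divergenceSet H := by
    intro g ω hω
    by_contra hne
    have h := tsum_density_bact hm H g ω
    exact ENNReal.mul_ne_top (density_ne_top hm _ ω) hne (h.symm.trans hω)
  refine ⟨fun h => ?_, key g ω⟩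
  simpa [bact_inv_bact] using key g⁻¹ _ h

theorem image_divergenceSet (hm : 2 ≤ m) (H : Subgroup (FreeGroup (Fin m))) (g : H) :
    bact (g : FreeGroup (Fin m)) '' divergenceSet H = divergenceSet H := by
  rw [image_bact]
  ext ω
  exact bact_mem_divergenceSet_iff hm H g⁻¹ ω

theorem finite_one_le_density {H : Subgroup (FreeGroup (Fin m))} {ω : Boundary m}
    (hω : ω ∉ divergenceSet H) :
    {h : H | 1 ≤ density (h : FreeGroup (Fin m)) ω}.Finite :=
  ENNReal.finite_const_le_of_tsum_ne_top hω one_ne_zero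

theorem density_pow_of_bact_eq (hm : 2 ≤ m) {g : FreeGroup (Fin m)} {ω : Boundary m}
    (h : bact g ω = ω) (n : ℕ) : density (g ^ n) ω = density g ω ^ n := by
  have h' : bact g⁻¹ ω = ω := by
    conv_lhs => rw [← h]
    exact bact_inv_bact g ω
  induction n with
  | zero => simp [density_one]
  | succ n ih => rw [pow_succ', density_mul hm, h', ih, pow_succ']

/-- Points outside the divergence set have trivial stabilizers. -/
theorem eq_one_of_bact_eq (hm : 2 ≤ m) {H : Subgroup (FreeGroup (Fin m))} {ω : Boundary m}
    (hω : ω ∉ divergenceSet H) {g : H} (hg : bact (g : FreeGroup (Fin m)) ω = ω) : g = 1 := by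
  have key : ∀ g : H, bact (g : FreeGroup (Fin m)) ω = ω →
      1 ≤ density (g : FreeGroup (Fin m)) ω → g = 1 := by
    intro g hg hd
    by_contra hne
    have hne' : (g : FreeGroup (Fin m)) ≠ 1 := by simpa using hne
    have hinj : Function.Injective fun n : ℕ => g ^ n := by
      intro a b hab
      refine IsMulTorsionFree.pow_right_injective hne' ?_
      simpa using congrArg Subtype.val hab
    refine Set.infinite_of_injective_forall_mem hinj (fun n => ?_) (finite_one_le_density hω)
    simp only [Set.mem_ofPred_eq, Subgroup.coe_pow, density_pow_of_bact_eq hm hg]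
    exact one_le_pow₀ hd
  have hg' : bact ((g⁻¹ : H) : FreeGroup (Fin m)) ω = ω := by
    conv_lhs => rw [← hg]
    exact bact_inv_bact _ ω
  rcases le_total 1 (density (g : FreeGroup (Fin m)) ω) with h | h
  · exact key g hg h
  · refine inv_eq_one.1 (key g⁻¹ hg' ?_)
    have h1 := density_mul_density_inv hm (g : FreeGroup (Fin m)) ω
    rw [← Subgroup.coe_inv, hg'] at h1
    rw [← h1]
    exact mul_le_of_le_one_left' h

instance : StandardBorelSpace (Boundary m) := by
  refine MeasurableSet.standardBorel ?_
  have h : {ω : ℕ → Letter m | IsRedSeq ω} =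
      ⋂ n, (fun ω : ℕ → Letter m => (ω (n + 1), ω n)) ⁻¹' {p | p.1 ≠ linv p.2} := by
    ext ω
    simp [IsRedSeq]
  change MeasurableSet {ω : ℕ → Letter m | IsRedSeq ω}
  rw [h]
  exact MeasurableSet.iInter fun n =>
    ((measurable_pi_apply (n + 1)).prodMk (measurable_pi_apply n)) (MeasurableSet.of_discrete)

/-- A fundamental domain for the action of `H` outside the divergence set: the points of maximal
density in their orbit, with ties broken by an injection of the boundary into `ℝ`. -/
def dissipativeDomain (H : Subgroup (FreeGroup (Fin m))) : Set (Boundary m) :=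
  {ω | ω ∉ divergenceSet H ∧ ∀ h : H, density (h : FreeGroup (Fin m)) ω < 1 ∨
    density (h : FreeGroup (Fin m)) ω = 1 ∧ embeddingReal (Boundary m) ω ≤
      embeddingReal (Boundary m) (bact (h : FreeGroup (Fin m))⁻¹ ω)}

theorem measurableSet_dissipativeDomain (H : Subgroup (FreeGroup (Fin m))) :
    MeasurableSet (dissipativeDomain H) := by
  have hφ := measurable_embeddingReal (Boundary m)
  refine (measurableSet_divergenceSet H).compl.inter ?_
  have h : {ω : Boundary m | ∀ h : H, density (h : FreeGroup (Fin m)) ω < 1 ∨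
      density (h : FreeGroup (Fin m)) ω = 1 ∧ embeddingReal (Boundary m) ω ≤
        embeddingReal (Boundary m) (bact (h : FreeGroup (Fin m))⁻¹ ω)} =
      ⋂ h : H, ({ω | density (h : FreeGroup (Fin m)) ω < 1} ∪
        ({ω | density (h : FreeGroup (Fin m)) ω = 1} ∩ {ω | embeddingReal (Boundary m) ω ≤
          embeddingReal (Boundary m) (bact (h : FreeGroup (Fin m))⁻¹ ω)})) := by
    ext ω
    simp
  refine (MeasurableSet.iInter fun h => ?_).congr h.symm
  exact (measurableSet_lt (measurable_density _) measurable_const).union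
    ((measurableSet_eq_fun (measurable_density _) measurable_const).inter
      (measurableSet_le hφ (hφ.comp (measurable_bact _))))

theorem eq_one_of_bact_mem_dissipativeDomain (hm : 2 ≤ m) {H : Subgroup (FreeGroup (Fin m))}
    {g : H} {ω : Boundary m} (hω : ω ∈ dissipativeDomain H)
    (hgω : bact (g : FreeGroup (Fin m)) ω ∈ dissipativeDomain H) : g = 1 := by
  have h1 := hω.2 g⁻¹
  have h2 := hgω.2 g
  have h3 := density_mul_density_inv hm (g : FreeGroup (Fin m)) (bact g ω)
  rw [bact_inv_bact] at h2 h3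
  rw [Subgroup.coe_inv, inv_inv] at h1
  have hle : density (g : FreeGroup (Fin m))⁻¹ ω ≤ 1 := h1.elim le_of_lt fun h => h.1.le
  have hle' : density (g : FreeGroup (Fin m)) (bact g ω) ≤ 1 :=
    h2.elim le_of_lt fun h => h.1.le
  have e1 : ¬ density (g : FreeGroup (Fin m))⁻¹ ω < 1 := fun h =>
    (((mul_le_of_le_one_left' hle').trans_lt h).ne h3)
  have e2 : ¬ density (g : FreeGroup (Fin m)) (bact g ω) < 1 := fun h =>
    (((mul_le_of_le_one_right' hle).trans_lt h).ne h3)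
  have heq := le_antisymm (h2.resolve_left e2).2 (h1.resolve_left e1).2
  exact eq_one_of_bact_eq hm hω.1
    ((measurableEmbedding_embeddingReal (Boundary m)).injective heq)

theorem exists_bact_mem_dissipativeDomain (hm : 2 ≤ m) {H : Subgroup (FreeGroup (Fin m))}
    {ω : Boundary m} (hω : ω ∉ divergenceSet H) :
    ∃ g : H, bact (g : FreeGroup (Fin m))⁻¹ ω ∈ dissipativeDomain H := by
  obtain ⟨g, hg, hmax⟩ := Set.exists_max_image _
    (fun h : H => toLex (density (h : FreeGroup (Fin m)) ω,
      OrderDual.toDual (embeddingReal (Boundary m) (bact (h : FreeGroup (Fin m))⁻¹ ω))))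
    (finite_one_le_density hω) ⟨1, by simp [density_one]⟩
  refine ⟨g, fun h => hω ?_, fun h => ?_⟩
  · exact (bact_mem_divergenceSet_iff hm H g⁻¹ ω).1 h
  · have hd := density_mul hm (g : FreeGroup (Fin m)) h ω
    have h0 : density (g : FreeGroup (Fin m)) ω ≠ 0 := (zero_lt_one.trans_le hg).ne'
    have htop := density_ne_top hm (g : FreeGroup (Fin m)) ω
    rw [← bact_mul, ← mul_inv_rev]
    by_contra! hcon
    have hle : density (g : FreeGroup (Fin m)) ω ≤
        density (g * h : FreeGroup (Fin m)) ω := by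
      rw [hd]
      exact le_mul_of_one_le_right' hcon.1
    have := hmax (g * h) (le_trans hg hle)
    simp only [Prod.Lex.toLex_le_toLex, Subgroup.coe_mul, OrderDual.toDual_le_toDual] at this
    rcases this with h1 | ⟨h1, h2⟩
    · exact h1.not_ge hle
    · have h3 : density (h : FreeGroup (Fin m)) (bact (g : FreeGroup (Fin m))⁻¹ ω) = 1 := by
        rw [hd] at h1
        exact (ENNReal.mul_right_inj h0 htop).1 (h1.trans (mul_one _).symm)
      exact (hcon.2 h3).not_ge h2

theorem iUnion_image_dissipativeDomain (hm : 2 ≤ m) (H : Subgroup (FreeGroup (Fin m))) :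
    ⋃ h : H, bact (h : FreeGroup (Fin m)) '' dissipativeDomain H = (divergenceSet H)ᶜ := by
  ext ω
  simp only [Set.mem_iUnion, image_bact, Set.mem_preimage, Set.mem_compl_iff]
  refine ⟨fun ⟨h, hω⟩ hS => hω.1 ?_, exists_bact_mem_dissipativeDomain hm⟩
  exact (bact_mem_divergenceSet_iff hm H h⁻¹ ω).2 hS

theorem disjoint_image_dissipativeDomain (hm : 2 ≤ m) {H : Subgroup (FreeGroup (Fin m))}
    {h h' : H} (hne : h ≠ h') :
    bact (h : FreeGroup (Fin m)) '' dissipativeDomain H ∩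
      bact (h' : FreeGroup (Fin m)) '' dissipativeDomain H = ∅ := by
  rw [Set.eq_empty_iff_forall_notMem]
  rintro _ ⟨⟨ω, hω, rfl⟩, ⟨ω', hω', he⟩⟩
  refine hne (inv_mul_eq_one.1 (eq_one_of_bact_mem_dissipativeDomain hm (g := h'⁻¹ * h) hω ?_)).symm
  rw [Subgroup.coe_mul, bact_mul, ← he, Subgroup.coe_inv, bact_inv_bact]
  exact hω'

theorem exists_recurrent_of_subset_divergenceSet (hm : 2 ≤ m) (μ : Measure (Boundary m))
    [IsProbabilityMeasure μ]
    (hμ : ∀ g : FreeGroup (Fin m), g ≠ 1 →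
      μ (cylinder g) = ((2 * m * (2 * m - 1) ^ (wlen g - 1) : ℕ) : ℝ≥0∞)⁻¹)
    {H : Subgroup (FreeGroup (Fin m))} {A : Set (Boundary m)} (hA : MeasurableSet A)
    (hAS : A ⊆ divergenceSet H) (hpos : 0 < μ A) :
    ∃ h : H, h ≠ 1 ∧ 0 < μ (A ∩ bact (h : FreeGroup (Fin m)) '' A) := by
  by_contra! hcon
  have hpre : ∀ (g : FreeGroup (Fin m)) {E : Set (Boundary m)}, MeasurableSet E →
      μ (bact g ⁻¹' E) = ∫⁻ ω in E, density g ω ∂μ := fun g E hE => by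
    rw [← Measure.map_apply (measurable_bact g) hE, map_bact_eq_withDensity hm μ hμ,
      withDensity_apply _ hE]
  have hmeas : ∀ g : FreeGroup (Fin m), MeasurableSet (bact g ⁻¹' A) :=
    fun g => measurable_bact g hA
  have hdisj : Pairwise (Function.onFun (AEDisjoint μ)
      fun h : H => bact (h : FreeGroup (Fin m)) ⁻¹' A) := by
    intro h h' hne
    have hnull : μ (A ∩ bact ((h * h'⁻¹ : H) : FreeGroup (Fin m)) '' A) = 0 :=
      nonpos_iff_eq_zero.1 (hcon (h * h'⁻¹) fun h1 => hne (mul_inv_eq_one.1 h1))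
    have hE : bact (h : FreeGroup (Fin m)) ⁻¹' A ∩ bact (h' : FreeGroup (Fin m)) ⁻¹' A =
        bact (h : FreeGroup (Fin m)) ⁻¹'
          (A ∩ bact ((h * h'⁻¹ : H) : FreeGroup (Fin m)) '' A) := by
      ext ω
      rw [image_bact]
      simp [bact_mul, bact_inv_bact]
    change μ (_ ∩ _) = 0
    rw [hE, hpre _ (hA.inter (image_bact _ A ▸ hmeas _))]
    exact setLIntegral_measure_zero _ _ hnull
  have hsum := measure_iUnion₀ hdisj fun h => (hmeas h).nullMeasurableSet
  have htop : ∑' h : H, μ (bact (h : FreeGroup (Fin m)) ⁻¹' A) = ⊤ := by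
    simp only [hpre _ hA]
    rw [← lintegral_tsum fun h : H => (measurable_density _).aemeasurable,
      setLIntegral_congr_fun hA fun ω hω => hAS hω, setLIntegral_const,
      ENNReal.top_mul hpos.ne']
  exact measure_ne_top μ _ (hsum.trans htop)

end Hopf

/-- **Hopf decomposition of the boundary action.** The `H`-invariant set `Σ` where the
Busemann–Poincaré series diverges coincides (mod 0) with the conservative part of the
action of `H ≤ F` on `(∂F, μ)`. -/
theorem boundary_action_hopf_decomposition (m : ℕ) (hm : 2 ≤ m)
    (μ : Measure (Boundary m)) [IsProbabilityMeasure μ]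
    (hμ : ∀ g : FreeGroup (Fin m), g ≠ 1 →
      μ (cylinder g) = ((2 * m * (2 * m - 1) ^ (wlen g - 1) : ℕ) : ℝ≥0∞)⁻¹)
    (H : Subgroup (FreeGroup (Fin m)))
    (SigH : Set (Boundary m))
    (hSig : SigH = {ω : Boundary m |
      ∑' h : H, ((2 * m - 1 : ℕ) : ℝ≥0∞) ^ (-(busemann (h : FreeGroup (Fin m)) ω)) = ⊤}) :
    -- Σ is H-invariant
    (∀ h : H, bact (h : FreeGroup (Fin m)) '' SigH = SigH) ∧
    -- (i) every positive measure subset of Σ is recurrent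
    (∀ A : Set (Boundary m), MeasurableSet A → A ⊆ SigH → 0 < μ A →
      ∃ h : H, h ≠ 1 ∧ 0 < μ (A ∩ bact (h : FreeGroup (Fin m)) '' A)) ∧
    -- (ii) the complement of Σ is covered (mod 0) by the translates of a wandering set
    (∃ W : Set (Boundary m), MeasurableSet W ∧
      (∀ h h' : H, h ≠ h' →
        μ (bact (h : FreeGroup (Fin m)) '' W ∩ bact (h' : FreeGroup (Fin m)) '' W) = 0) ∧
      μ ((⋃ h : H, bact (h : FreeGroup (Fin m)) '' W) ∆ SigHᶜ) = 0) := by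
  have hS : SigH = divergenceSet H := hSig
  subst hS
  refine ⟨image_divergenceSet hm H, fun A hA hAS hpos =>
    exists_recurrent_of_subset_divergenceSet hm μ hμ hA hAS hpos,
    dissipativeDomain H, measurableSet_dissipativeDomain H, fun h h' hne => ?_, ?_⟩
  · rw [disjoint_image_dissipativeDomain hm hne, measure_empty]
  · rw [iUnion_image_dissipativeDomain hm H, symmDiff_self, Set.bot_eq_empty, measure_empty]
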